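/- arXiv:1404.3805 — 3 statements merged into one kernel-verified Lean document; each statement's English description precedes it below -/
import Mathlib

section
/- Let S_1 ⊆ S_2 ⊆ … ⊆ S_n be a chain of admissible subsets of [±n], and let λ be the Young diagram defined by λ_i = |S_{n+1−i}| (so λ_1 ≥ … ≥ λ_n ≥ 1 and λ_1 ≤ n). Then in R^B_n one has τ_{S_1}·τ_{S_2}⋯τ_{S_n} = 2^{n−λ_1}·I(λ)·τ_{{1}}·τ_{{1,2}}⋯τ_{{1,…,n}}. (This is the algebraic form of the type B_n intersection-number formula ⟨τ_{S_1}⋯τ_{S_n}, μ_X⟩ = 2^{n−λ_1} I(λ).) -/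
open MvPolynomial

/-- The set `[±n]`, realized as `Fin n × Bool`: `(k, true) ↔ k+1` and `(k, false) ↔ −(k+1)`. -/
abbrev PM (n : ℕ) := Fin n × Bool

/-- Negation on `[±n]`. -/
def negPM {n : ℕ} (p : PM n) : PM n := (p.1, !p.2)

/-- A subset `S ⊆ [±n]` is admissible if it is nonempty and contains no pair `{i, −i}`. -/
def Adm (n : ℕ) (S : Finset (PM n)) : Prop :=
  S.Nonempty ∧ ∀ p ∈ S, negPM p ∉ S

instance (n : ℕ) (S : Finset (PM n)) : Decidable (Adm n S) := by unfold Adm; infer_instance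

/-- Index type of the variables of `R^B_n`: the admissible subsets of `[±n]`. -/
abbrev IdxB (n : ℕ) := {S : Finset (PM n) // Adm n S}

/-- Generators of the defining ideal of `R^B_n`: (i) products `τ_S τ_T` for incomparable `S, T`;
(ii) the linear relations `Σ_{k∈S} τ_S − Σ_{−k∈S} τ_S` for `k ∈ {1,…,n}`. -/
def relB (n : ℕ) : Set (MvPolynomial (IdxB n) ℤ) :=
  {p | ∃ S T : IdxB n, ¬ S.1 ⊆ T.1 ∧ ¬ T.1 ⊆ S.1 ∧ p = X S * X T} ∪
  {p | ∃ k : Fin n, p =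
      (∑ S : IdxB n, if (k, true) ∈ S.1 then X S else 0) -
      (∑ S : IdxB n, if (k, false) ∈ S.1 then X S else 0)}

/-- The ring `R^B_n`. -/
abbrev RB (n : ℕ) := MvPolynomial (IdxB n) ℤ ⧸ Ideal.span (relB n)

/-- The class `τ_S ∈ R^B_n` of an admissible subset `S ⊆ [±n]`. -/
noncomputable def tauB (n : ℕ) (S : Finset (PM n)) : RB n :=
  if h : Adm n S then Ideal.Quotient.mk _ (X (⟨S, h⟩ : IdxB n)) else 1

/-- The subset `{1,…,i}` of `[±n]`. -/
def initSegB (n i : ℕ) : Finset (PM n) :=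
  Finset.univ.filter (fun p : PM n => p.2 = true ∧ (p.1 : ℕ) < i)

/-- The class of a point: `τ_{{1}} ⋯ τ_{{1,…,n}}`. -/
noncomputable def ptB (n : ℕ) : RB n := ∏ i ∈ Finset.Icc 1 n, tauB n (initSegB n i)


/-- `λ_i` extended by `0` for `i > n`. -/
def lamE (n : ℕ) (lam : ℕ → ℕ) (i : ℕ) : ℕ := if i ≤ n then lam i else 0

/-- The sorted list `i_1 < … < i_s` of lower-right corners of `λ`. -/
def cornerL (n : ℕ) (lam : ℕ → ℕ) : List ℕ :=
  ((Finset.Icc 1 n).filter (fun i => lamE n lam (i + 1) < lamE n lam i)).sort (· ≤ ·)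

/-- The number `s` of lower-right corners of `λ`. -/
def sC (n : ℕ) (lam : ℕ → ℕ) : ℕ := (cornerL n lam).length

/-- `i_r` (with `i_0 = 0`; out-of-range indices default to `n+1`, where `λ` vanishes). -/
def iC (n : ℕ) (lam : ℕ → ℕ) (r : ℕ) : ℕ :=
  if r = 0 then 0 else (cornerL n lam).getD (r - 1) (n + 1)

/-- `a_r = i_r − i_{r−1} − 1`. -/
def aC (n : ℕ) (lam : ℕ → ℕ) (r : ℕ) : ℤ := (iC n lam r : ℤ) - iC n lam (r - 1) - 1

/-- `b_r = λ_{i_r} − λ_{i_{r+1}} − 1` (with `λ_{i_{s+1}} = 0`). -/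
def bC (n : ℕ) (lam : ℕ → ℕ) (r : ℕ) : ℤ :=
  (lamE n lam (iC n lam r) : ℤ) - lamE n lam (iC n lam (r + 1)) - 1

/-- `c_r = λ_{i_r} + i_r − n − 1`. -/
def cC (n : ℕ) (lam : ℕ → ℕ) (r : ℕ) : ℤ :=
  (lamE n lam (iC n lam r) : ℤ) + iC n lam r - n - 1

/-- Binomial coefficient `C(x,y)` with `C(x,y) = 0` unless `0 ≤ y ≤ x`. -/
def Cb (x y : ℤ) : ℤ := if 0 ≤ y ∧ y ≤ x then (x.toNat.choose y.toNat : ℤ) else 0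

/-- `y_r = C(a_r, c_r) · C(b_r, c_r)`. -/
def yC (n : ℕ) (lam : ℕ → ℕ) (r : ℕ) : ℤ :=
  Cb (aC n lam r) (cC n lam r) * Cb (bC n lam r) (cC n lam r)

/-- `I(λ) = (−1)^{n+s} y_1 ⋯ y_s`. -/
def IY (n : ℕ) (lam : ℕ → ℕ) : ℤ :=
  (-1) ^ (n + sC n lam) * ∏ r ∈ Finset.Icc 1 (sC n lam), yC n lam r

namespace TypeB

variable {n : ℕ}

lemma tauB_mul_eq_zero {S T : Finset (PM n)} (hS : Adm n S) (hT : Adm n T)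
    (h₁ : ¬ S ⊆ T) (h₂ : ¬ T ⊆ S) : tauB n S * tauB n T = 0 := by
  rw [tauB, tauB, dif_pos hS, dif_pos hT, ← map_mul]
  exact Ideal.Quotient.eq_zero_iff_mem.2
    (Ideal.subset_span (Or.inl ⟨⟨S, hS⟩, ⟨T, hT⟩, h₁, h₂, rfl⟩))

lemma sum_tauB_eq (p : PM n) :
    ∑ S with Adm n S ∧ p ∈ S, tauB n S = ∑ S with Adm n S ∧ negPM p ∈ S, tauB n S := by
  have key : ∀ q : PM n, ∑ S with Adm n S ∧ q ∈ S, tauB n S =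
      Ideal.Quotient.mk (Ideal.span (relB n))
        (∑ S : IdxB n, if q ∈ S.1 then X S else 0) := by
    intro q
    rw [map_sum, ← Finset.filter_filter, Finset.sum_filter,
      Finset.sum_subtype (p := Adm n) _ (by simp)]
    refine Finset.sum_congr rfl fun S _ => ?_
    split_ifs <;> simp [tauB, S.2]
  have pos : ∀ k : Fin n, ∑ S with Adm n S ∧ (k, true) ∈ S, tauB n S =
      ∑ S with Adm n S ∧ (k, false) ∈ S, tauB n S := by
    intro k
    rw [key, key, Ideal.Quotient.eq]
    exact Ideal.subset_span (Or.inr ⟨k, rfl⟩)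
  obtain ⟨k, _ | _⟩ := p
  · exact (pos k).symm
  · exact pos k

lemma negPM_negPM (p : PM n) : negPM (negPM p) = p := by simp [negPM]

lemma adm_mono {S T : Finset (PM n)} (hT : Adm n T) (hS : S.Nonempty) (h : S ⊆ T) : Adm n S :=
  ⟨hS, fun p hp hn => hT.2 p (h hp) (h hn)⟩

lemma adm_injOn_fst {S : Finset (PM n)} (hS : Adm n S) :
    Set.InjOn Prod.fst (S : Set (PM n)) := by
  rintro ⟨i, b⟩ hi ⟨j, c⟩ hj (rfl : i = j)
  by_contra hne
  have hbc : (!b) = c := by cases b <;> cases c <;> simp_all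
  subst hbc
  exact hS.2 _ hi hj

lemma adm_card_le {S : Finset (PM n)} (hS : Adm n S) : S.card ≤ n := by
  simpa using Finset.card_le_card_of_injOn (t := Finset.univ) _ (by simp) (adm_injOn_fst hS)

/-- `M` annihilates the class of every admissible set incomparable with `T`. -/
def Kills (M : RB n) (T : Finset (PM n)) : Prop :=
  ∀ S, Adm n S → ¬ S ⊆ T → ¬ T ⊆ S → tauB n S * M = 0

lemma kills_empty (M : RB n) : Kills M ∅ := fun _ _ _ h => (h (Finset.empty_subset _)).elim

lemma Kills.of_dvd {M N : RB n} {T : Finset (PM n)} (h : Kills M T) (hd : M ∣ N) : Kills N T := by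
  obtain ⟨c, rfl⟩ := hd
  intro S hS h₁ h₂
  rw [← mul_assoc, h S hS h₁ h₂, zero_mul]

lemma kills_tauB {T : Finset (PM n)} (hT : Adm n T) : Kills (tauB n T) T :=
  fun _ hS h₁ h₂ => tauB_mul_eq_zero hS hT h₁ h₂

lemma sum_mem_mul_eq_zero {M : RB n} {T : Finset (PM n)} (hT : Adm n T) (hM : Kills M T)
    {p : PM n} (hp : p ∈ T) : ∑ S with Adm n S ∧ p ∈ S, tauB n S * M = 0 := by
  rw [← Finset.sum_mul, sum_tauB_eq, Finset.sum_mul]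
  refine Finset.sum_eq_zero fun S hS => ?_
  simp only [Finset.mem_filter, Finset.mem_univ, true_and] at hS
  refine hM S hS.1 (fun h => hT.2 p hp (h hS.2)) fun h => hS.1.2 p (h hp) hS.2

/-- The relation obtained from an element of `T \ P`. -/
lemma sum_Icc_add_sum_ssubset {M : RB n} {P T : Finset (PM n)} (hT : Adm n T)
    (hMT : Kills M T) (hMP : Kills M P) {p : PM n} (hp : p ∈ T) (hpP : p ∉ P) :
    ∑ S ∈ Finset.Icc (insert p P) T, tauB n S * M +
      ∑ S with Adm n S ∧ T ⊂ S, tauB n S * M = 0 := by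
  rw [← sum_mem_mul_eq_zero hT hMT hp, ← Finset.sum_union]
  · refine Finset.sum_subset ?_ ?_
    · intro S hS
      simp only [Finset.mem_union, Finset.mem_Icc, Finset.mem_filter,
        Finset.mem_univ, true_and] at hS ⊢
      rcases hS with ⟨h₁, h₂⟩ | ⟨h₁, h₂⟩
      · have := h₁ (Finset.mem_insert_self p P)
        exact ⟨adm_mono hT ⟨p, this⟩ h₂, this⟩
      · exact ⟨h₁, h₂.1 hp⟩
    · intro S hS hS'
      simp only [Finset.mem_union, Finset.mem_Icc, Finset.mem_filter,
        Finset.mem_univ, true_and, not_or, not_and] at hS hS'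
      obtain ⟨hA, hpS⟩ := hS
      by_cases h₁ : S ⊆ T
      · refine hMP S hA (fun h => hpP (h hpS)) fun h => hS'.1 ?_ h₁
        exact Finset.insert_subset hpS h
      · exact hMT S hA h₁ fun h => hS'.2 hA ⟨h, h₁⟩
  · rw [Finset.disjoint_left]
    intro S hS hS'
    simp only [Finset.mem_Icc, Finset.mem_filter,
      Finset.mem_univ, true_and] at hS hS'
    exact hS'.2.2 hS.2

lemma sum_ssubset_eq_sum_Ioc {M : RB n} {T U : Finset (PM n)} (hT : T.Nonempty) (hU : Adm n U)
    (hMT : Kills M T) (hMU : Kills M U) {p : PM n} (hp : p ∈ U) (hpT : p ∉ T) :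
    ∑ S with Adm n S ∧ T ⊂ S, tauB n S * M =
      ∑ S ∈ Finset.Ioc T (U.erase p), tauB n S * M := by
  have h0 := sum_mem_mul_eq_zero hU hMU hp
  rw [← Finset.sum_filter_add_sum_filter_not _ (fun S => p ∈ S)]
  have h1 : ∑ S ∈ Finset.univ.filter (fun S => Adm n S ∧ T ⊂ S) with p ∈ S, tauB n S * M = 0 := by
    rw [← h0]
    refine Finset.sum_subset ?_ ?_
    · intro S; simp; tauto
    · intro S hS hS'
      simp only [Finset.mem_filter, Finset.mem_univ, true_and, not_and] at hS hS'
      refine hMT S hS.1 (fun h => hpT (h hS.2)) fun h => hS' ⟨hS.1, h, fun h' => hpT (h' hS.2)⟩ hS.2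
  rw [h1, zero_add]
  symm
  refine Finset.sum_subset ?_ ?_
  · intro S hS
    simp only [Finset.mem_Ioc, Finset.subset_erase,
      Finset.mem_filter, Finset.mem_univ, true_and] at hS ⊢
    exact ⟨⟨adm_mono hU (hT.mono hS.1.1) hS.2.1, hS.1⟩, hS.2.2⟩
  · intro S hS hS'
    simp only [Finset.mem_Ioc, Finset.subset_erase,
      Finset.mem_filter, Finset.mem_univ, true_and, not_and] at hS hS'
    exact hMU S hS.1.1 (fun h => hS' hS.1.2 h hS.2) fun h => hS.2 (h hp)

lemma negPM_ne (p : PM n) : negPM p ≠ p := by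
  intro h
  have := congrArg Prod.snd h
  simp [negPM] at this

lemma adm_insert {P : Finset (PM n)} {p : PM n} (hP : ∀ q ∈ P, negPM q ∉ P) (hp : negPM p ∉ P) :
    Adm n (insert p P) := by
  refine ⟨⟨p, Finset.mem_insert_self p P⟩, fun q hq hq' => ?_⟩
  rw [Finset.mem_insert] at hq hq'
  rcases hq with rfl | hq
  · rcases hq' with h | h
    · exact negPM_ne _ h
    · exact hp h
  · rcases hq' with h | h
    · exact hp (by rwa [← h, negPM_negPM])
    · exact hP q hq h

/-- `l` is an increasing list of admissible sets completing `P` to a full flag. -/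
def IsFlag : Finset (PM n) → List (Finset (PM n)) → Prop
  | P, [] => P.card = n
  | P, S :: l => Adm n S ∧ (∃ p, p ∉ P ∧ S = insert p P) ∧ IsFlag S l

lemma IsFlag_card_add_length {P : Finset (PM n)} {l : List (Finset (PM n))} (h : IsFlag P l) :
    P.card + l.length = n := by
  induction l generalizing P with
  | nil => exact h
  | cons S l ih =>
    obtain ⟨-, ⟨p, hp, rfl⟩, h⟩ := h
    have := ih h
    rw [Finset.card_insert_of_notMem hp] at this
    simp only [List.length_cons]
    omega

lemma exists_fst_notMem {P : Finset (PM n)} (hP : P.card < n) : ∃ k : Fin n, ∀ p ∈ P, p.1 ≠ k := by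
  have : (P.image Prod.fst).card < (Finset.univ : Finset (Fin n)).card := by
    simpa using Finset.card_image_le.trans_lt hP
  obtain ⟨k, -, hk⟩ := Finset.exists_mem_notMem_of_card_lt_card this
  exact ⟨k, fun p hp h => hk (Finset.mem_image.2 ⟨p, hp, h⟩)⟩

lemma exists_isFlag {P : Finset (PM n)} (hP : ∀ q ∈ P, negPM q ∉ P) (hc : P.card ≤ n) :
    ∃ l, IsFlag P l := by
  obtain h | h := hc.eq_or_lt
  · exact ⟨[], h⟩
  · obtain ⟨k, hk⟩ := exists_fst_notMem h
    have h1 : (k, true) ∉ P := fun h => hk _ h rfl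
    have h2 : negPM (k, true) ∉ P := fun h => hk _ h rfl
    have hA := adm_insert hP h2
    obtain ⟨l, hl⟩ := exists_isFlag hA.2 (adm_card_le hA)
    exact ⟨_ :: l, hA, ⟨_, h1, rfl⟩, hl⟩
  termination_by n - P.card
  decreasing_by rw [Finset.card_insert_of_notMem h1]; omega

lemma Icc_insert_insert {P : Finset (PM n)} {a b : PM n} :
    Finset.Icc (insert a P) (insert b (insert a P)) =
      {insert a P, insert b (insert a P)} := by
  ext S
  simp only [Finset.mem_Icc, Finset.mem_insert, Finset.mem_singleton]
  constructor
  · rintro ⟨h₁, h₂⟩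
    by_cases hb : b ∈ S
    · exact Or.inr (h₂.antisymm (Finset.insert_subset hb h₁))
    · exact Or.inl (((Finset.subset_insert_iff_of_notMem hb).1 h₂).antisymm h₁)
  · rintro (rfl | rfl)
    · exact ⟨subset_rfl, Finset.subset_insert _ _⟩
    · exact ⟨Finset.subset_insert _ _, subset_rfl⟩

lemma exchange {E : RB n} {P : Finset (PM n)} (hE : Kills E P) {a b : PM n} (ha : a ∉ P)
    (hb : b ∉ P) (hab : a ≠ b) (hT : Adm n (insert b (insert a P))) :
    tauB n (insert a P) * (E * tauB n (insert b (insert a P))) =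
      tauB n (insert b P) * (E * tauB n (insert b (insert a P))) := by
  have hMT := (kills_tauB hT).of_dvd (Dvd.intro_left E rfl)
  have hMP := hE.of_dvd (Dvd.intro (tauB n (insert b (insert a P))) rfl)
  have h1 := sum_Icc_add_sum_ssubset hT hMT hMP (by simp : a ∈ _) ha
  have h2 := sum_Icc_add_sum_ssubset hT hMT hMP (by simp : b ∈ _) hb
  rw [Icc_insert_insert, Finset.sum_pair] at h1
  · rw [Finset.insert_comm b a P, Icc_insert_insert, Finset.sum_pair] at h2
    · rw [Finset.insert_comm b a P] at h1 ⊢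
      linear_combination h1 - h2
    · intro h
      have : a ∈ insert b P := by rw [h]; simp
      exact (Finset.mem_insert.1 this).elim hab ha
  · intro h
    have : b ∈ insert a P := by rw [h]; simp
    exact (Finset.mem_insert.1 this).elim hab.symm hb

lemma tauB_insert_negPM_mul {E : RB n} {P : Finset (PM n)} (hE : Kills E P) {a : PM n}
    (ha : a ∉ P) (ha' : negPM a ∉ P) (h₁ : Adm n (insert a P)) (h₂ : Adm n (insert (negPM a) P))
    (hc : P.card + 1 = n) :
    tauB n (insert a P) * E = tauB n (insert (negPM a) P) * E := by
  have key : ∀ c : PM n, c ∉ P → Adm n (insert c P) →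
      (∑ S with Adm n S ∧ c ∈ S, tauB n S) * E = tauB n (insert c P) * E := by
    intro c hcP hcA
    rw [Finset.sum_mul]
    refine Finset.sum_eq_single_of_mem (insert c P) (by simpa using hcA) fun S hS hne => ?_
    simp only [Finset.mem_filter, Finset.mem_univ, true_and] at hS
    refine hE S hS.1 (fun h => hcP (h hS.2)) fun h => hne ?_
    refine (Finset.eq_of_subset_of_card_le (Finset.insert_subset hS.2 h) ?_).symm
    rw [Finset.card_insert_of_notMem hcP, hc]
    exact adm_card_le hS.1
  rw [← key a ha h₁, ← key _ ha' h₂, sum_tauB_eq]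

lemma flag_prod_eq {E : RB n} {P : Finset (PM n)} (hE : Kills E P) {l l' : List (Finset (PM n))}
    (hl : IsFlag P l) (hl' : IsFlag P l') :
    E * (l.map (tauB n)).prod = E * (l'.map (tauB n)).prod := by
  induction hr : l.length generalizing E P l l' with
  | zero =>
    have h1 := IsFlag_card_add_length hl
    have h2 := IsFlag_card_add_length hl'
    have h3 : l'.length = 0 := by omega
    rw [List.length_eq_zero_iff.1 hr, List.length_eq_zero_iff.1 h3]
  | succ r ih =>
    have kills : ∀ {S}, Adm n S → Kills (E * tauB n S) S := fun h =>
      (kills_tauB h).of_dvd (Dvd.intro_left E rfl)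
    have swap : ∀ {a b : PM n} {x y}, a ∉ P → b ∉ P → Adm n (insert a P) → Adm n (insert b P) →
        IsFlag (insert a P) x → IsFlag (insert b P) y → b ≠ negPM a → x.length = r →
        E * tauB n (insert a P) * (x.map (tauB n)).prod =
          E * tauB n (insert b P) * (y.map (tauB n)).prod := by
      intro a b x y ha hb hA hB hx hy hne hxr
      by_cases hab : a = b
      · subst hab
        exact ih (kills hA) hx hy hxr
      have hnb : negPM b ∉ insert a P := by
        rw [Finset.mem_insert, not_or]
        refine ⟨fun h => hne ?_, fun h => hB.2 b (by simp) (Finset.mem_insert_of_mem h)⟩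
        rw [← h, negPM_negPM]
      have hT := adm_insert hA.2 hnb
      have hbi : b ∉ insert a P := by simp [hb, Ne.symm hab]
      have hai : a ∉ insert b P := by simp [ha, hab]
      obtain ⟨z, hz⟩ := exists_isFlag hT.2 (adm_card_le hT)
      have hx' : IsFlag (insert a P) (insert b (insert a P) :: z) := ⟨hT, ⟨b, hbi, rfl⟩, hz⟩
      have hy' : IsFlag (insert b P) (insert b (insert a P) :: z) :=
        ⟨hT, ⟨a, hai, Finset.insert_comm _ _ _⟩, hz⟩
      have hyr : y.length = r := by
        have h1 := IsFlag_card_add_length hx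
        have h2 := IsFlag_card_add_length hy
        rw [Finset.card_insert_of_notMem ha] at h1
        rw [Finset.card_insert_of_notMem hb] at h2
        omega
      rw [ih (kills hA) hx hx' hxr, ih (kills hB) hy hy' hyr]
      simp only [List.map_cons, List.prod_cons]
      linear_combination (z.map (tauB n)).prod * exchange hE ha hb hab hT
    obtain _ | ⟨S, x⟩ := l
    · simp at hr
    obtain _ | ⟨S', y⟩ := l'
    · have h1 := IsFlag_card_add_length hl
      have h2 := IsFlag_card_add_length hl'
      simp at h1 h2
      omega
    obtain ⟨hA, ⟨a, ha, rfl⟩, hx⟩ := hl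
    obtain ⟨hB, ⟨b, hb, rfl⟩, hy⟩ := hl'
    have hxr : x.length = r := by simpa using hr
    have hcard := IsFlag_card_add_length hx
    have hcard' := IsFlag_card_add_length hy
    rw [Finset.card_insert_of_notMem ha] at hcard
    rw [Finset.card_insert_of_notMem hb] at hcard'
    simp only [List.map_cons, List.prod_cons, ← mul_assoc]
    by_cases hne : b = negPM a
    · subst hne
      obtain rfl | hr0 := Nat.eq_zero_or_pos r
      · have hy0 : y.length = 0 := by omega
        rw [List.length_eq_zero_iff.1 hxr, List.length_eq_zero_iff.1 hy0]
        have := tauB_insert_negPM_mul hE ha hb hA hB (by omega)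
        simp only [List.map_nil, List.prod_nil]
        linear_combination this
      · obtain ⟨k, hk⟩ := exists_fst_notMem (P := insert a P)
          (by rw [Finset.card_insert_of_notMem ha]; omega)
        have hc : (k, true) ∉ P := fun h => hk _ (Finset.mem_insert_of_mem h) rfl
        have hc' : negPM (k, true) ∉ P := fun h => hk _ (Finset.mem_insert_of_mem h) rfl
        have hka : a.1 ≠ k := hk a (Finset.mem_insert_self a P)
        have hC : Adm n (insert (k, true) P) :=
          adm_insert (fun q hq h => hA.2 q (Finset.mem_insert_of_mem hq)
            (Finset.mem_insert_of_mem h)) hc'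
        obtain ⟨z, hz⟩ := exists_isFlag hC.2 (adm_card_le hC)
        have hzr : z.length = r := by
          have := IsFlag_card_add_length hz
          rw [Finset.card_insert_of_notMem hc] at this
          omega
        rw [swap ha hc hA hC hx hz (fun h => hka (congrArg Prod.fst h).symm) hxr]
        refine swap hc hb hC hB hz hy (fun h => hka ?_) hzr
        simpa [negPM] using congrArg Prod.fst h
    · exact swap ha hb hA hB hx hy hne hxr

lemma card_initSegB {i : ℕ} (hi : i ≤ n) : (initSegB n i).card = i := by
  have : initSegB n i = (Finset.univ.filter fun k : Fin n => (k : ℕ) < i).image (·, true) := by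
    ext ⟨k, b⟩
    cases b <;> simp [initSegB]
  rw [this, Finset.card_image_of_injective _ (Prod.mk_left_injective true),
    Fin.card_filter_val_lt, min_eq_right hi]

lemma adm_initSegB {i : ℕ} (h0 : 0 < i) (hi : i ≤ n) : Adm n (initSegB n i) := by
  refine ⟨Finset.card_pos.1 (by rw [card_initSegB hi]; exact h0), fun p hp hq => ?_⟩
  simp only [initSegB, negPM, Finset.mem_filter, Finset.mem_univ, true_and] at hp hq
  simp [hp.1] at hq

lemma isFlag_initSegB {m i : ℕ} (h : i + m = n) :
    IsFlag (initSegB n i) ((List.range' (i + 1) m).map (initSegB n)) := by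
  induction m generalizing i with
  | zero => exact card_initSegB (by omega) |>.trans (by omega)
  | succ m ih =>
    refine ⟨adm_initSegB (by omega) (by omega), ⟨(⟨i, by omega⟩, true), ?_, ?_⟩, ih (by omega)⟩
    · simp [initSegB]
    · ext ⟨k, b⟩
      simp only [initSegB, Finset.mem_filter, Finset.mem_univ, true_and, Finset.mem_insert,
        Prod.mk.injEq, Fin.ext_iff]
      cases b <;> simp
      omega

lemma flag_prod_eq_ptB {l : List (Finset (PM n))} (hl : IsFlag ∅ l) :
    (l.map (tauB n)).prod = ptB n := by
  have h := isFlag_initSegB (n := n) (m := n) (i := 0) (by simp)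
  have h0 : initSegB n 0 = ∅ := by simp [initSegB]
  rw [h0] at h
  have := flag_prod_eq (kills_empty 1) hl h
  rw [one_mul, one_mul] at this
  rw [this, ptB, List.map_map, Nat.Icc_eq_range']
  rfl

lemma Cb_of_neg {x y : ℤ} (h : y < 0) : Cb x y = 0 := if_neg (by omega)

lemma Cb_of_lt {x y : ℤ} (h : x < y) : Cb x y = 0 := if_neg (by omega)

lemma Cb_natCast (x y : ℕ) : Cb x y = x.choose y := by
  unfold Cb
  split_ifs with h
  · simp
  · rw [Nat.choose_eq_zero_of_lt (by omega), Nat.cast_zero]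

lemma Cb_zero_right {x : ℤ} (h : 0 ≤ x) : Cb x 0 = 1 := by simp [Cb, h]

lemma Cb_self {x : ℤ} (h : 0 ≤ x) : Cb x x = 1 := by simp [Cb, h]

lemma Cb_symm (x y : ℤ) : Cb x y = Cb x (x - y) := by
  unfold Cb
  split_ifs with h h' h'
  · rw [show (x - y).toNat = x.toNat - y.toNat by omega, Nat.choose_symm (by omega)]
  · omega
  · omega
  · rfl

lemma Cb_succ (k : ℕ) (y : ℤ) : Cb (k + 1) y = Cb k y + Cb k (y - 1) := by
  obtain h | h | h := lt_trichotomy y 0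
  · rw [Cb_of_neg h, Cb_of_neg h, Cb_of_neg (by omega), add_zero]
  · subst h
    rw [Cb_zero_right (by omega), Cb_zero_right (by omega), Cb_of_neg (by omega), add_zero]
  · obtain ⟨j, rfl⟩ : ∃ j : ℕ, y = j + 1 := ⟨(y - 1).toNat, by omega⟩
    have := Cb_natCast (k + 1) (j + 1)
    have h2 := Cb_natCast k (j + 1)
    push_cast at this h2
    rw [this, h2, add_sub_cancel_right, Cb_natCast, Nat.choose_succ_succ]
    push_cast
    ring

lemma card_filter_Icc {α : Type*} [DecidableEq α] {A B : Finset α} (h : A ⊆ B) (r : ℕ) :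
    ((Finset.Icc A B).filter fun S => S.card = A.card + r).card = (B.card - A.card).choose r := by
  rw [← Finset.card_sdiff_of_subset h, ← Finset.card_powersetCard]
  symm
  refine Finset.card_bij (fun X _ => A ∪ X) ?_ ?_ ?_
  · intro X hX
    rw [Finset.mem_powersetCard] at hX
    rw [Finset.mem_filter, Finset.mem_Icc, Finset.card_union_of_disjoint, hX.2]
    · exact ⟨⟨Finset.subset_union_left, Finset.union_subset h (hX.1.trans Finset.sdiff_subset)⟩, rfl⟩
    · exact Finset.disjoint_of_subset_right hX.1 Finset.disjoint_sdiff
  · intro X hX Y hY hXY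
    rw [Finset.mem_powersetCard] at hX hY
    have key : ∀ Z ⊆ B \ A, (A ∪ Z) \ A = Z := fun Z hZ => by
      rw [Finset.union_sdiff_left, Finset.sdiff_eq_self_iff_disjoint]
      exact Finset.disjoint_of_subset_left hZ Finset.sdiff_disjoint
    rw [← key X hX.1, ← key Y hY.1]
    exact congrArg (· \ A) hXY
  · intro S hS
    rw [Finset.mem_filter, Finset.mem_Icc] at hS
    refine ⟨S \ A, ?_, Finset.union_sdiff_of_subset hS.1.1⟩
    rw [Finset.mem_powersetCard, Finset.card_sdiff_of_subset hS.1.1, hS.2]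
    exact ⟨Finset.sdiff_subset_sdiff hS.1.2 subset_rfl, by omega⟩

lemma card_filter_adm_ssubset {T : Finset (PM n)} (hT : Adm n T) (hn : T.card < n) :
    ((Finset.univ.filter fun S => Adm n S ∧ T ⊂ S).filter fun S => S.card = n).card =
      2 ^ (n - T.card) := by
  have hinj : ∀ S : Finset (PM n), Adm n S → (S.image Prod.fst).card = S.card :=
    fun S hS => Finset.card_image_of_injOn (adm_injOn_fst hS)
  have hc : (Finset.univ \ T.image Prod.fst).card = n - T.card := by
    rw [Finset.card_sdiff_of_subset (Finset.subset_univ _), hinj T hT]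
    simp
  rw [← hc, ← Finset.card_powerset]
  symm
  let f : Finset (Fin n) → Finset (PM n) := fun X =>
    Finset.univ.filter fun p => p ∈ T ∨ (p.1 ∉ T.image Prod.fst ∧ (p.2 = true ↔ p.1 ∈ X))
  have hf : ∀ X p, p ∈ f X ↔ p ∈ T ∨ ((∀ q ∈ T, q.1 ≠ p.1) ∧ (p.2 = true ↔ p.1 ∈ X)) := by
    intro X p
    simp only [f, Finset.mem_filter, Finset.mem_univ, true_and, Finset.mem_image, not_exists,
      not_and, ne_eq]
  have himg : ∀ X, (f X).image Prod.fst = Finset.univ := by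
    intro X
    ext k
    simp only [Finset.mem_image, Finset.mem_univ, iff_true]
    by_cases hk : ∃ q ∈ T, q.1 = k
    · obtain ⟨q, hq, rfl⟩ := hk
      exact ⟨q, (hf _ _).2 (Or.inl hq), rfl⟩
    · push Not at hk
      exact ⟨(k, decide (k ∈ X)), (hf _ _).2 (Or.inr ⟨hk, by simp⟩), rfl⟩
  have hTf : ∀ X, T ⊆ f X := fun X p hp => (hf _ _).2 (Or.inl hp)
  have hadm : ∀ X, Adm n (f X) := by
    intro X
    refine ⟨hT.1.mono (hTf X), fun p hp hq => ?_⟩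
    rw [hf] at hp hq
    rcases hp with hp | hp
    · rcases hq with hq | hq
      · exact hT.2 p hp hq
      · exact hq.1 p hp rfl
    · rcases hq with hq | hq
      · exact hp.1 _ hq rfl
      · have h := hp.2.trans hq.2.symm
        cases h' : p.2 <;> simp [negPM, h'] at h
  refine Finset.card_bij (fun X _ => f X) ?_ ?_ ?_
  · intro X _
    have hcard : (f X).card = n := by rw [← hinj _ (hadm X), himg]; simp
    simp only [Finset.mem_filter, Finset.mem_univ, true_and]
    refine ⟨⟨hadm X, hTf X, fun h => ?_⟩, hcard⟩
    have := Finset.card_le_card h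
    omega
  · intro X hX Y hY hXY
    have key : ∀ Z ⊆ Finset.univ \ T.image Prod.fst, ∀ k,
        k ∈ Z ↔ k ∉ T.image Prod.fst ∧ (k, true) ∈ f Z := by
      intro Z hZ k
      rw [hf]
      simp only [Finset.subset_iff, Finset.mem_sdiff, Finset.mem_univ, true_and, Finset.mem_image,
        not_exists, not_and] at hZ ⊢
      constructor
      · exact fun h => ⟨hZ h, Or.inr ⟨hZ h, by simpa using h⟩⟩
      · rintro ⟨h, h' | h'⟩
        · exact (h _ h' rfl).elim
        · simpa using h'.2
    ext k
    rw [key X (Finset.mem_powerset.1 hX), key Y (Finset.mem_powerset.1 hY)]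
    rw [hXY]
  · intro S hS
    simp only [Finset.mem_filter, Finset.mem_univ, true_and] at hS
    obtain ⟨⟨hSA, hTS⟩, hSn⟩ := hS
    refine ⟨Finset.univ.filter fun k => k ∉ T.image Prod.fst ∧ (k, true) ∈ S, ?_, ?_⟩
    · rw [Finset.mem_powerset]
      intro k hk
      rw [Finset.mem_filter] at hk
      exact Finset.mem_sdiff.2 ⟨hk.1, hk.2.1⟩
    · refine Finset.eq_of_subset_of_card_le ?_ ?_
      · intro p hp
        rw [hf] at hp
        rcases hp with hp | ⟨h₁, h₂⟩
        · exact hTS.1 hp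
        · have hu : S.image Prod.fst = Finset.univ := by
            rw [← Finset.card_eq_iff_eq_univ, hinj S hSA, hSn, Fintype.card_fin]
          have hp1 : p.1 ∈ S.image Prod.fst := by rw [hu]; exact Finset.mem_univ _
          obtain ⟨q, hq, hqp⟩ := Finset.mem_image.1 hp1
          obtain ⟨i, b⟩ := p
          obtain ⟨j, c⟩ := q
          obtain rfl : j = i := hqp
          have h₃ : (b = true ↔ (j, true) ∈ S) := by
            simpa [fun b h => h₁ (j, b) h rfl, show ∀ b, (j, b) ∉ T from
              fun b h => h₁ (j, b) h rfl] using h₂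
          have h₄ := hSA.2 _ hq
          cases b <;> cases c <;> simp_all [negPM]
      · rw [hSn, ← hinj _ (hadm _), himg]
        simp

/-- The largest set of a decreasing list of sets with multiplicities. -/
def headSet : List (Finset (PM n) × ℕ) → Finset (PM n)
  | [] => ∅
  | x :: _ => x.1

/-- The factor contributed by the gap between a set of size `t` and the next larger set of the
chain, of size `u`; `none` stands for the gap above the largest set. -/
def gap : Option ℕ → ℤ → ℤ → ℤ
  | none, _, e => 2 ^ e.toNat
  | some u, t, e => Cb (u - t - 1) e

/-- The product of the local factors of a decreasing chain with multiplicities, apart from the gap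
above its largest set; `M` is the sum of the multiplicities. -/
def tailWeight : ℤ → List (Finset (PM n) × ℕ) → ℤ
  | _, [] => 1
  | M, (T, m) :: A => (-1) ^ (m + 1) * Cb (m - 1) (M - T.card) *
      Cb (T.card - (headSet A).card - 1) (M - m - (headSet A).card) * tailWeight (M - m) A

/-- The intersection number of a decreasing chain with multiplicities. -/
def weight (M : ℤ) (u : Option ℕ) (L : List (Finset (PM n) × ℕ)) : ℤ :=
  gap u (headSet L).card (M - (headSet L).card) * tailWeight M L

lemma gap_some (u : ℕ) (t e : ℤ) : gap (some u) t e = Cb (u - t - 1) e := rfl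

lemma weight_cons (M : ℤ) (u : Option ℕ) (T : Finset (PM n)) (m : ℕ) (A) :
    weight M u ((T, m) :: A) = gap u T.card (M - T.card) * ((-1) ^ (m + 1) *
      Cb (m - 1) (M - T.card)) * weight (M - m) (some T.card) A := by
  simp only [weight, headSet, tailWeight, gap_some]
  ring

lemma exists_weight_append (B : List (Finset (PM n) × ℕ)) (U : Finset (PM n)) (m : ℕ) (M : ℤ)
    (u : Option ℕ) : ∃ c, ∀ X, weight M u (B ++ (U, m) :: X) =
      c * weight (M - (B.map Prod.snd).sum - m) (some U.card) X := by
  induction B generalizing M u with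
  | nil => exact ⟨_, fun X => by simpa using weight_cons M u U m X⟩
  | cons b B ih =>
    obtain ⟨c, hc⟩ := ih (M - b.2) (some b.1.card)
    refine ⟨gap u b.1.card (M - b.1.card) * ((-1) ^ (b.2 + 1) * Cb (b.2 - 1) (M - b.1.card)) * c,
      fun X => ?_⟩
    rw [List.cons_append, weight_cons, hc, ← mul_assoc, List.map_cons, List.sum_cons, Nat.cast_add,
      sub_sub M]

lemma sum_weight_below (M : ℤ) (u : Option ℕ) {T : Finset (PM n)} {k : ℕ}
    {A : List (Finset (PM n) × ℕ)} (hPT : headSet A ⊆ T) {p : PM n} (hp : p ∈ T)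
    (hpP : p ∉ headSet A) :
    ∑ S ∈ Finset.Ico (insert p (headSet A)) T, weight M u ((T, k + 1) :: (S, 1) :: A) =
      gap u T.card (M - T.card) * (-1) ^ k * Cb k (M - T.card) *
        weight (M - (k + 2)) (some T.card) A := by
  set q := (headSet A).card with hq
  have hcard : ∀ S ∈ Finset.Ico (insert p (headSet A)) T, q < S.card ∧ S.card < T.card := by
    intro S hS
    rw [Finset.mem_Ico] at hS
    have h1 := Finset.card_le_card hS.1
    rw [Finset.card_insert_of_notMem hpP] at h1
    exact ⟨h1, Finset.card_lt_card hS.2⟩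
  have hqt : q + 1 ≤ T.card := by
    rw [hq, ← Finset.card_insert_of_notMem hpP]
    exact Finset.card_le_card (Finset.insert_subset hp hPT)
  set c := gap u T.card (M - T.card) * (-1) ^ k * Cb k (M - T.card) * tailWeight (M - (k + 2)) A
    with hc
  have hw : ∀ S ∈ Finset.Ico (insert p (headSet A)) T,
      weight M u ((T, k + 1) :: (S, 1) :: A) =
        if (S.card : ℤ) = M - (k + 1) then c else 0 := by
    intro S hS
    obtain ⟨h1, h2⟩ := hcard S hS
    rw [weight_cons, weight_cons]
    simp only [weight, gap_some, ← hq]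
    split_ifs with h
    · push_cast
      rw [show M - (k + 1 : ℤ) - S.card = 0 by omega, show M - (k + 1 : ℤ) - 1 - q = S.card - q - 1
        by omega, Cb_zero_right (by omega), Cb_self (by omega), Cb_self (by omega), hc]
      rw [show (k : ℤ) + 1 - 1 = k by ring, show M - (k + 1 : ℤ) - 1 = M - (k + 2) by ring]
      ring
    · simp only [Nat.cast_add, Nat.cast_one, sub_self]
      have : Cb (1 - 1) (M - (k + 1 : ℤ) - S.card) = 0 := if_neg (by omega)
      rw [show (1 - 1 : ℤ) = 0 by norm_num] at this
      rw [this]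
      ring
  rw [Finset.sum_congr rfl hw, ← Finset.sum_filter, Finset.sum_const, nsmul_eq_mul]
  simp only [weight, gap_some, ← hq]
  suffices h : (((Finset.Ico (insert p (headSet A)) T).filter
      fun S => (S.card : ℤ) = M - (k + 1)).card : ℤ) * Cb k (M - T.card) =
      Cb (T.card - q - 1) (M - (k + 2) - q) * Cb k (M - T.card) by
    rw [hc]
    linear_combination gap u T.card (M - T.card) * (-1) ^ k * tailWeight (M - (k + 2)) A * h
  by_cases hTM : (T.card : ℤ) ≤ M - (k + 1)
  · rw [Cb_of_lt (show (k : ℤ) < M - T.card by omega), mul_zero, mul_zero]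
  congr 1
  by_cases hpos : M - (k + 2) - q < 0
  · rw [Cb_of_neg hpos, Nat.cast_eq_zero, Finset.card_eq_zero, Finset.filter_eq_empty_iff]
    intro S hS
    have := hcard S hS
    omega
  obtain ⟨r, hr⟩ : ∃ r : ℕ, M - (k + 2) - q = r := ⟨(M - (k + 2) - q).toNat, by omega⟩
  have hI := card_filter_Icc (Finset.insert_subset hp hPT) r
  rw [Finset.card_insert_of_notMem hpP, ← hq] at hI
  rw [hr, show (T.card : ℤ) - q - 1 = ((T.card - (q + 1) : ℕ) : ℤ) by omega, Cb_natCast, ← hI]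
  congr 2
  ext S
  simp only [Finset.mem_filter, Finset.mem_Ico, Finset.mem_Icc]
  constructor
  · rintro ⟨⟨h1, h2⟩, h3⟩
    exact ⟨⟨h1, h2.1⟩, by omega⟩
  · rintro ⟨⟨h1, h2⟩, h3⟩
    refine ⟨⟨h1, lt_of_le_of_ne h2 ?_⟩, by omega⟩
    rintro rfl
    omega

lemma sum_weight_above (M : ℤ) (u : Option ℕ) {T : Finset (PM n)} {k : ℕ}
    {A : List (Finset (PM n) × ℕ)} (I : Finset (Finset (PM n))) (hI : ∀ S ∈ I, T.card < S.card)
    (hgap : ∀ S ∈ I, gap u S.card 0 = 1)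
    (hcount : ∀ j : ℕ, 1 ≤ j → M = T.card + j →
      ((I.filter fun S => S.card = T.card + j).card : ℤ) = gap u T.card j) :
    ∑ S ∈ I, weight M u ((S, 1) :: (T, k + 1) :: A) =
      gap u T.card (M - T.card) * (-1) ^ k * Cb k (M - T.card - 1) *
        weight (M - (k + 2)) (some T.card) A := by
  by_cases hM : M ≤ T.card
  · rw [Cb_of_neg (show M - T.card - 1 < 0 by omega), mul_zero, zero_mul]
    refine Finset.sum_eq_zero fun S hS => ?_
    have := hI S hS
    rw [weight_cons, Cb_of_neg (show M - S.card < 0 by omega)]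
    ring
  obtain ⟨j, hj⟩ : ∃ j : ℕ, M = T.card + j := ⟨(M - T.card).toNat, by omega⟩
  have hw : ∀ S ∈ I, weight M u ((S, 1) :: (T, k + 1) :: A) =
      if S.card = T.card + j then (-1) ^ k * Cb k (M - T.card - 1) *
        weight (M - (k + 2)) (some T.card) A else 0 := by
    intro S hS
    have := hI S hS
    rw [weight_cons, weight_cons]
    split_ifs with h
    · have h0 : M - (S.card : ℤ) = 0 := by omega
      rw [h0, hgap S hS, gap_some, show Cb ((1 : ℕ) - 1) 0 = 1 from rfl]
      push_cast
      rw [show (S.card : ℤ) - T.card - 1 = M - 1 - T.card by omega, Cb_self (by omega),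
        show M - 1 - ((k : ℤ) + 1) = M - (k + 2) by ring,
        show (k : ℤ) + 1 - 1 = k by ring, show M - 1 - (T.card : ℤ) = M - T.card - 1 by ring]
      ring
    · have : Cb ((1 : ℕ) - 1) (M - S.card) = 0 := by
        unfold Cb
        rw [if_neg (by push_cast; omega)]
      rw [this]
      ring
  rw [Finset.sum_congr rfl hw, ← Finset.sum_filter, Finset.sum_const, nsmul_eq_mul,
    hcount j (by omega) hj, show M - (T.card : ℤ) = j by omega]
  ring

lemma weight_add_sum_add_sum (M : ℤ) (u : Option ℕ) {T : Finset (PM n)} {k : ℕ}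
    {A : List (Finset (PM n) × ℕ)} (hPT : headSet A ⊆ T) {p : PM n} (hp : p ∈ T)
    (hpP : p ∉ headSet A) (I : Finset (Finset (PM n))) (hI : ∀ S ∈ I, T.card < S.card)
    (hgap : ∀ S ∈ I, gap u S.card 0 = 1)
    (hcount : ∀ j : ℕ, 1 ≤ j → M = T.card + j →
      ((I.filter fun S => S.card = T.card + j).card : ℤ) = gap u T.card j) :
    weight M u ((T, k + 2) :: A) +
      ∑ S ∈ Finset.Ico (insert p (headSet A)) T, weight M u ((T, k + 1) :: (S, 1) :: A) +
      ∑ S ∈ I, weight M u ((S, 1) :: (T, k + 1) :: A) = 0 := by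
  rw [sum_weight_below M u hPT hp hpP, sum_weight_above M u I hI hgap hcount, weight_cons]
  push_cast
  rw [show (k : ℤ) + 2 - 1 = k + 1 by ring, Cb_succ]
  ring

/-- The monomial of a list of sets with multiplicities. -/
noncomputable def monom (L : List (Finset (PM n) × ℕ)) : RB n :=
  (L.map fun x => tauB n x.1 ^ x.2).prod

lemma monom_cons (x : Finset (PM n) × ℕ) (L : List (Finset (PM n) × ℕ)) :
    monom (x :: L) = tauB n x.1 ^ x.2 * monom L := by simp [monom]

lemma monom_append (L L' : List (Finset (PM n) × ℕ)) :
    monom (L ++ L') = monom L * monom L' := by simp [monom]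

/-- A strictly decreasing list of admissible sets with positive multiplicities. -/
structure IsWeightedChain (L : List (Finset (PM n) × ℕ)) : Prop where
  pairwise : L.Pairwise fun x y => y.1 ⊂ x.1
  adm : ∀ x ∈ L, Adm n x.1
  pos : ∀ x ∈ L, 1 ≤ x.2

lemma IsWeightedChain.of_cons {x : Finset (PM n) × ℕ} {L : List (Finset (PM n) × ℕ)}
    (h : IsWeightedChain (x :: L)) : IsWeightedChain L :=
  ⟨h.pairwise.of_cons, fun y hy => h.adm y (List.mem_cons_of_mem _ hy),
    fun y hy => h.pos y (List.mem_cons_of_mem _ hy)⟩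

lemma IsWeightedChain.headSet_ssubset {x : Finset (PM n) × ℕ} {L : List (Finset (PM n) × ℕ)}
    (h : IsWeightedChain (x :: L)) : headSet L ⊂ x.1 := by
  cases L with
  | nil => exact Finset.empty_ssubset.2 (h.adm x (by simp)).1
  | cons y L => exact (List.pairwise_cons.1 h.pairwise).1 y (by simp)

lemma IsWeightedChain.length_le {L : List (Finset (PM n) × ℕ)} (h : IsWeightedChain L) :
    L.length ≤ (headSet L).card := by
  induction L with
  | nil => simp
  | cons x L ih =>
    have h1 := ih h.of_cons
    have h2 := Finset.card_lt_card h.headSet_ssubset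
    simp only [List.length_cons, headSet]
    omega

lemma IsWeightedChain.kills {L : List (Finset (PM n) × ℕ)} (h : IsWeightedChain L)
    {x : Finset (PM n) × ℕ} (hx : x ∈ L) : Kills (monom L) x.1 :=
  (kills_tauB (h.adm x hx)).of_dvd <| (dvd_pow_self _ (by have := h.pos x hx; omega)).trans
    (List.dvd_prod (List.mem_map_of_mem (f := fun x => tauB n x.1 ^ x.2) hx))

lemma prod_mul_monom_eq_ptB {L : List (Finset (PM n) × ℕ)} (h : IsWeightedChain L)
    (h1 : ∀ x ∈ L, x.2 = 1) (hl : L.length = (headSet L).card) {X : List (Finset (PM n))}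
    (hX : IsFlag (headSet L) X) : (X.map (tauB n)).prod * monom L = ptB n := by
  induction L generalizing X with
  | nil => simpa [monom] using flag_prod_eq_ptB hX
  | cons x L ih =>
    have hs := h.headSet_ssubset
    have hlt := Finset.card_lt_card hs
    have hle := h.of_cons.length_le
    simp only [List.length_cons, headSet] at hl hX
    obtain ⟨p, hp, hpx⟩ := Finset.exists_eq_insert_iff.2 ⟨hs.1, (by omega : _ = x.1.card)⟩
    rw [← ih h.of_cons (fun y hy => h1 y (List.mem_cons_of_mem _ hy)) (by omega)
      (X := x.1 :: X) ⟨h.adm x (by simp), ⟨p, hp, hpx.symm⟩, hX⟩, monom_cons, h1 x (by simp)]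
    simp only [List.map_cons, List.prod_cons, pow_one]
    ring

lemma weight_eq_one {L : List (Finset (PM n) × ℕ)} (h : IsWeightedChain L)
    (h1 : ∀ x ∈ L, x.2 = 1) (hl : L.length = (headSet L).card) {u : Option ℕ}
    (hu : gap u L.length 0 = 1) : weight L.length u L = 1 := by
  induction L generalizing u with
  | nil => simpa [weight, tailWeight, headSet] using hu
  | cons x L ih =>
    have hlt := Finset.card_lt_card h.headSet_ssubset
    have hle := h.of_cons.length_le
    obtain ⟨T, m⟩ := x
    obtain rfl : m = 1 := h1 (T, m) (by simp)
    change _ = T.card at hl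
    change _ < T.card at hlt
    rw [weight_cons, ← hl, sub_self, hu]
    simp only [List.length_cons, Nat.cast_add, Nat.cast_one, add_sub_cancel_right, sub_self] at hl ⊢
    rw [ih h.of_cons (fun y hy => h1 y (List.mem_cons_of_mem _ hy)) (by omega)]
    · simp [Cb]
    · rw [gap_some]
      simp [Cb]

lemma IsWeightedChain.insert {B A : List (Finset (PM n) × ℕ)} {T S : Finset (PM n)} {k : ℕ}
    (h : IsWeightedChain (B ++ (T, k + 2) :: A)) (hS : Adm n S) :
    (headSet A ⊂ S → S ⊂ T → IsWeightedChain (B ++ (T, k + 1) :: (S, 1) :: A)) ∧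
    (T ⊂ S → (∀ b ∈ B, S ⊂ b.1) → IsWeightedChain (B ++ (S, 1) :: (T, k + 1) :: A)) := by
  obtain ⟨h1, h2, h3⟩ := h
  simp only [List.pairwise_append, List.pairwise_cons, List.mem_cons, forall_eq_or_imp] at h1
  simp only [List.mem_append, List.mem_cons] at h2 h3
  have hA : headSet A ⊂ S → ∀ a ∈ A, a.1 ⊂ S := by
    intro hAS
    cases A with
    | nil => simp
    | cons x A =>
      intro a ha
      obtain rfl | ha := List.mem_cons.1 ha
      · exact hAS
      · exact ((List.pairwise_cons.1 h1.2.1.2).1 a ha).trans hAS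
  refine ⟨fun hAS hST => ⟨?_, ?_, ?_⟩, fun hTS hB => ⟨?_, ?_, ?_⟩⟩
  · simp only [List.pairwise_append, List.pairwise_cons, List.mem_cons, forall_eq_or_imp]
    exact ⟨h1.1, ⟨⟨hST, h1.2.1.1⟩, hA hAS, h1.2.1.2⟩,
      fun b hb => ⟨(h1.2.2 b hb).1, hST.trans (h1.2.2 b hb).1, (h1.2.2 b hb).2⟩⟩
  · simp only [List.mem_append, List.mem_cons]
    rintro x (hx | rfl | rfl | hx)
    exacts [h2 x (.inl hx), h2 (T, k + 2) (.inr (.inl rfl)), hS, h2 x (.inr (.inr hx))]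
  · simp only [List.mem_append, List.mem_cons]
    rintro x (hx | rfl | rfl | hx)
    exacts [h3 x (.inl hx), Nat.le_add_left _ _, le_rfl, h3 x (.inr (.inr hx))]
  · simp only [List.pairwise_append, List.pairwise_cons, List.mem_cons, forall_eq_or_imp]
    exact ⟨h1.1, ⟨⟨hTS, fun a ha => (h1.2.1.1 a ha).trans hTS⟩, h1.2.1⟩,
      fun b hb => ⟨hB b hb, h1.2.2 b hb⟩⟩
  · simp only [List.mem_append, List.mem_cons]
    rintro x (hx | rfl | rfl | hx)
    exacts [h2 x (.inl hx), hS, h2 (T, k + 2) (.inr (.inl rfl)), h2 x (.inr (.inr hx))]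
  · simp only [List.mem_append, List.mem_cons]
    rintro x (hx | rfl | rfl | hx)
    exacts [h3 x (.inl hx), le_rfl, Nat.le_add_left _ _, h3 x (.inr (.inr hx))]

/-- The sets that can be inserted above `T`, with the resulting identities. -/
lemma exists_above {B A : List (Finset (PM n) × ℕ)} {T : Finset (PM n)} {k : ℕ} {M : RB n}
    (h : IsWeightedChain (B ++ (T, k + 2) :: A)) (hMT : Kills M T) (hMB : ∀ b ∈ B, Kills M b.1)
    {p : PM n} (hp : p ∈ T) (hpA : p ∉ headSet A) (hAT : headSet A ⊆ T) :
    ∃ I : Finset (Finset (PM n)),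
      ∑ S with Adm n S ∧ T ⊂ S, tauB n S * M = ∑ S ∈ I, tauB n S * M ∧
      (∀ S ∈ I, Adm n S ∧ T ⊂ S ∧ ∀ b ∈ B, S ⊂ b.1) ∧
      weight n none (B ++ (T, k + 2) :: A) +
        ∑ S ∈ Finset.Ico (insert p (headSet A)) T,
          weight n none (B ++ (T, k + 1) :: (S, 1) :: A) +
        ∑ S ∈ I, weight n none (B ++ (S, 1) :: (T, k + 1) :: A) = 0 := by
  have hT : Adm n T := h.adm (T, k + 2) (by simp)
  obtain rfl | ⟨B, ⟨U, m⟩, rfl⟩ := B.eq_nil_or_concat'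
  · refine ⟨Finset.univ.filter fun S => Adm n S ∧ T ⊂ S, rfl, ?_, ?_⟩
    · simp
    · refine weight_add_sum_add_sum n none hAT hp hpA _ ?_ ?_ ?_
      · intro S hS
        exact Finset.card_lt_card (Finset.mem_filter.1 hS).2.2
      · simp [gap]
      · intro j hj hn
        rw [show T.card + j = n by omega, card_filter_adm_ssubset hT (by omega)]
        simp [gap, show n - T.card = j by omega]
  · have hp1 := (List.pairwise_append.1 h.pairwise)
    have hTU : T ⊂ U := hp1.2.2 (U, m) (by simp) (T, k + 2) (by simp)
    have hU : Adm n U := h.adm (U, m) (by simp)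
    obtain ⟨p', hp', hpT'⟩ := Finset.exists_of_ssubset hTU
    have hUB : ∀ b ∈ B, U ⊂ b.1 := fun b hb =>
      (List.pairwise_append.1 hp1.1).2.2 b hb (U, m) (by simp)
    have hI : ∀ S ∈ Finset.Ioc T (U.erase p'), T ⊂ S ∧ S ⊂ U := fun S hS =>
      ⟨(Finset.mem_Ioc.1 hS).1, (Finset.mem_Ioc.1 hS).2.trans_ssubset (Finset.erase_ssubset hp')⟩
    refine ⟨Finset.Ioc T (U.erase p'),
      sum_ssubset_eq_sum_Ioc hT.1 hU hMT (hMB (U, m) (by simp)) hp' hpT', ?_, ?_⟩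
    · intro S hS
      have := hI S hS
      refine ⟨adm_mono hU (hT.1.mono this.1.1) this.2.1, this.1, fun b hb => ?_⟩
      rcases List.mem_append.1 hb with hb | hb
      · exact this.2.trans (hUB b hb)
      · rw [List.mem_singleton.1 hb]
        exact this.2
    · obtain ⟨c, hc⟩ := exists_weight_append B U m n none
      simp only [List.append_assoc, List.singleton_append, hc]
      rw [← Finset.mul_sum, ← Finset.mul_sum, ← mul_add, ← mul_add]
      refine mul_eq_zero_of_right c (weight_add_sum_add_sum _ _ hAT hp hpA _ ?_ ?_ ?_)
      · intro S hS
        exact Finset.card_lt_card (hI S hS).1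
      · intro S hS
        have := Finset.card_lt_card (hI S hS).2
        rw [gap_some, Cb_zero_right (by omega)]
      · intro j hj _
        have hle : T ⊆ U.erase p' := Finset.subset_erase.2 ⟨hTU.1, hpT'⟩
        have hcard := card_filter_Icc hle j
        have hlt := Finset.card_lt_card hTU
        rw [Finset.card_erase_of_mem hp'] at hcard
        rw [gap_some, show (U.card : ℤ) - T.card - 1 = ((U.card - 1 - T.card : ℕ) : ℤ) by omega,
          Cb_natCast, ← hcard]
        congr 2
        ext S
        simp only [Finset.mem_filter, Finset.mem_Ioc, Finset.mem_Icc]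
        constructor
        · rintro ⟨⟨h1, h2⟩, h3⟩
          exact ⟨⟨h1.1, h2⟩, h3⟩
        · rintro ⟨⟨h1, h2⟩, h3⟩
          refine ⟨⟨lt_of_le_of_ne h1 ?_, h2⟩, h3⟩
          rintro rfl
          omega

theorem monom_eq_weight_mul_ptB {L : List (Finset (PM n) × ℕ)} (h : IsWeightedChain L)
    (hsum : (L.map Prod.snd).sum = n) :
    monom L = ((weight n none L : ℤ) : RB n) * ptB n := by
  induction hd : n - L.length using Nat.strong_induction_on generalizing L with
  | _ d ih =>
  by_cases h1 : ∀ x ∈ L, x.2 = 1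
  · have hlen : L.length = n := by
      refine Eq.trans ?_ hsum
      rw [List.map_congr_left h1]
      simp
    have hle := h.length_le
    have hcard : (headSet L).card ≤ n := by
      cases L with
      | nil => simp [headSet]
      | cons x L => exact adm_card_le (h.adm x (by simp))
    have hw := weight_eq_one h h1 (by omega) (u := none) (by simp [gap])
    rw [hlen] at hw
    rw [hw, Int.cast_one, one_mul]
    simpa using prod_mul_monom_eq_ptB h h1 (by omega)
      (X := []) (show (headSet L).card = n by omega)
  push Not at h1
  obtain ⟨⟨T, m⟩, hx, hm⟩ := h1
  obtain ⟨k, rfl⟩ : ∃ k, m = k + 2 := ⟨m - 2, by have := h.pos _ hx; simp only at this hm; omega⟩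
  obtain ⟨B, A, rfl⟩ := List.append_of_mem hx
  have hlt : (B ++ (T, k + 2) :: A).length < n := by
    refine lt_of_lt_of_eq ?_ hsum
    have : ∀ l : List (Finset (PM n) × ℕ), (∀ x ∈ l, 1 ≤ x.2) →
        l.length ≤ (l.map Prod.snd).sum := fun l hl => by
      simpa using List.length_le_sum_of_one_le (l.map Prod.snd) (by simpa using fun b a h => hl (a, b) h)
    have hB := this B fun x hx => h.pos x (by simp [hx])
    have hA := this A fun x hx => h.pos x (by simp [hx])
    simp only [List.length_append, List.length_cons, List.map_append, List.map_cons,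
      List.sum_append, List.sum_cons]
    omega
  have hT : Adm n T := h.adm _ hx
  have hchain : IsWeightedChain ((T, k + 2) :: A) :=
    ⟨(List.pairwise_append.1 h.pairwise).2.1, fun x hx => h.adm x (by simp [List.mem_cons.1 hx]),
      fun x hx => h.pos x (by simp [List.mem_cons.1 hx])⟩
  have hAT : headSet A ⊂ T := hchain.headSet_ssubset
  obtain ⟨p, hp, hpA⟩ := Finset.exists_of_ssubset hAT
  have hM : IsWeightedChain (B ++ (T, k + 1) :: A) := by
    obtain ⟨h1, h2, h3⟩ := h
    simp only [List.mem_append, List.mem_cons] at h2 h3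
    refine ⟨?_, ?_, ?_⟩
    · simpa only [List.pairwise_append, List.pairwise_cons, List.mem_cons, forall_eq_or_imp] using h1
    · simp only [List.mem_append, List.mem_cons]
      rintro x (hx | rfl | hx)
      exacts [h2 x (.inl hx), hT, h2 x (.inr (.inr hx))]
    · simp only [List.mem_append, List.mem_cons]
      rintro x (hx | rfl | hx)
      exacts [h3 x (.inl hx), Nat.le_add_left _ _, h3 x (.inr (.inr hx))]
  set M := monom (B ++ (T, k + 1) :: A) with hMdef
  have hMT : Kills M T := hM.kills (x := (T, k + 1)) (by simp)
  have hMA : Kills M (headSet A) := by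
    cases A with
    | nil => exact kills_empty M
    | cons x A => exact hM.kills (x := x) (by simp)
  obtain ⟨I, hI1, hI2, hI3⟩ := exists_above h hMT (fun b hb => hM.kills (by simp [hb])) hp hpA hAT.1
  have rel := sum_Icc_add_sum_ssubset hT hMT hMA hp hpA
  have hbelow : ∀ S ∈ Finset.Ico (insert p (headSet A)) T, tauB n S * M =
      ((weight n none (B ++ (T, k + 1) :: (S, 1) :: A) : ℤ) : RB n) * ptB n := by
    intro S hS
    rw [Finset.mem_Ico] at hS
    have hAS : headSet A ⊂ S := (Finset.ssubset_insert hpA).trans_subset hS.1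
    have hSA : Adm n S := adm_mono hT ⟨p, hS.1 (Finset.mem_insert_self _ _)⟩ hS.2.1
    refine Eq.trans ?_ (ih _ ?_ ((h.insert hSA).1 hAS hS.2) ?_ rfl)
    · simp only [hMdef, monom_append, monom_cons]
      ring
    · simp only [List.length_append, List.length_cons] at hd hlt ⊢
      omega
    · simp only [List.map_append, List.map_cons, List.sum_append, List.sum_cons] at hsum ⊢
      omega
  have habove : ∀ S ∈ I, tauB n S * M =
      ((weight n none (B ++ (S, 1) :: (T, k + 1) :: A) : ℤ) : RB n) * ptB n := by
    intro S hS
    obtain ⟨hSA, hTS, hSB⟩ := hI2 S hS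
    refine Eq.trans ?_ (ih _ ?_ ((h.insert hSA).2 hTS hSB) ?_ rfl)
    · simp only [hMdef, monom_append, monom_cons]
      ring
    · simp only [List.length_append, List.length_cons] at hd hlt ⊢
      omega
    · simp only [List.map_append, List.map_cons, List.sum_append, List.sum_cons] at hsum ⊢
      omega
  have hle : insert p (headSet A) ≤ T := Finset.insert_subset hp hAT.1
  rw [hI1, ← Finset.Ico_insert_right hle, Finset.sum_insert Finset.right_notMem_Ico,
    Finset.sum_congr rfl hbelow, Finset.sum_congr rfl habove, ← Finset.sum_mul, ← Finset.sum_mul,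
    ← Int.cast_sum, ← Int.cast_sum] at rel
  have hcast := congrArg (Int.cast : ℤ → RB n) hI3
  rw [Int.cast_add, Int.cast_add, Int.cast_zero] at hcast
  have hL : monom (B ++ (T, k + 2) :: A) = tauB n T * M := by
    simp only [hMdef, monom_append, monom_cons]
    ring
  rw [hL]
  linear_combination rel - ptB n * hcast

/-- The corners of `λ` strictly beyond position `a`, in increasing order. -/
structure IsCornersFrom (lam : ℕ → ℕ) (a : ℕ) (l : List ℕ) : Prop where
  pairwise : l.Pairwise (· < ·)
  mem_iff : ∀ x, x ∈ l ↔ (a < x ∧ x ≤ n) ∧ lamE n lam (x + 1) < lamE n lam x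

lemma isCornersFrom_cornerL (lam : ℕ → ℕ) : IsCornersFrom (n := n) lam 0 (cornerL n lam) := by
  refine ⟨(Finset.sortedLT_sort _).pairwise, fun x => ?_⟩
  simp only [cornerL, Finset.mem_sort, Finset.mem_filter, Finset.mem_Icc, Nat.succ_le_iff]

lemma IsCornersFrom.of_cons {lam : ℕ → ℕ} {a i : ℕ} {l : List ℕ}
    (h : IsCornersFrom (n := n) lam a (i :: l)) : IsCornersFrom (n := n) lam i l := by
  obtain ⟨h1, h2⟩ := h
  rw [List.pairwise_cons] at h1
  have hi := (h2 i).1 (by simp)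
  refine ⟨h1.2, fun x => ⟨fun hx => ?_, fun hx => ?_⟩⟩
  · have := (h2 x).1 (by simp [hx])
    exact ⟨⟨h1.1 x hx, this.1.2⟩, this.2⟩
  · have := (h2 x).2 ⟨⟨hi.1.1.trans hx.1.1, hx.1.2⟩, hx.2⟩
    exact (List.mem_cons.1 this).resolve_left hx.1.1.ne'

/-- The decreasing chain with multiplicities read off from a list of corners. -/
def cornerChain (F : ℕ → Finset (PM n)) : ℕ → List ℕ → List (Finset (PM n) × ℕ)
  | _, [] => []
  | a, i :: l => (F i, i - a) :: cornerChain F i l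

variable {F : ℕ → Finset (PM n)}

lemma lamE_card {i : ℕ} (hi : i ≤ n) : lamE n (fun i => (F i).card) i = (F i).card := if_pos hi

lemma IsCornersFrom.eq_of_mem_Ioc (hF : ∀ i j, 1 ≤ i → i ≤ j → j ≤ n → F j ⊆ F i) {a i : ℕ}
    {l : List ℕ} (h : IsCornersFrom (n := n) (fun i => (F i).card) a (i :: l)) {x : ℕ}
    (hax : a < x) (hxi : x ≤ i) : F x = F i := by
  have hi := ((h.mem_iff i).1 (by simp)).1.2
  induction hxi using Nat.decreasingInduction with
  | self => rfl
  | of_succ x hx ih =>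
    rw [← ih (by omega)]
    have hnot : x ∉ i :: l := by
      simp only [List.mem_cons, not_or]
      exact ⟨hx.ne, fun hxl => hx.not_gt ((List.pairwise_cons.1 h.pairwise).1 x hxl)⟩
    rw [h.mem_iff, lamE_card (by omega), lamE_card (by omega)] at hnot
    exact (Finset.eq_of_subset_of_card_le (hF x (x + 1) (by omega) (by omega) (by omega))
      (by by_contra hc; exact hnot ⟨by omega, by omega⟩)).symm

lemma IsCornersFrom.le_of_nil (hA : ∀ i ∈ Finset.Icc 1 n, Adm n (F i)) {a : ℕ}
    (h : IsCornersFrom (n := n) (fun i => (F i).card) a []) : n ≤ a := by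
  by_contra! ha
  refine List.not_mem_nil ((h.mem_iff n).2 ⟨⟨ha, le_rfl⟩, ?_⟩)
  rw [lamE_card le_rfl, lamE, if_neg (by omega)]
  exact (hA n (by simp; omega)).1.card_pos

lemma prod_Ioc_eq_monom_cornerChain (hA : ∀ i ∈ Finset.Icc 1 n, Adm n (F i))
    (hF : ∀ i j, 1 ≤ i → i ≤ j → j ≤ n → F j ⊆ F i) {a : ℕ} {l : List ℕ}
    (h : IsCornersFrom (n := n) (fun i => (F i).card) a l) :
    ∏ i ∈ Finset.Ioc a n, tauB n (F i) = monom (cornerChain F a l) := by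
  induction l generalizing a with
  | nil => simp [cornerChain, monom, Finset.Ioc_eq_empty_of_le (h.le_of_nil hA)]
  | cons i l ih =>
    have hi := ((h.mem_iff i).1 (by simp)).1
    rw [← Finset.prod_Ioc_consecutive _ hi.1.le hi.2, ih h.of_cons, cornerChain, monom_cons]
    congr 1
    rw [Finset.prod_congr rfl fun x hx => by
      rw [h.eq_of_mem_Ioc hF (Finset.mem_Ioc.1 hx).1 (Finset.mem_Ioc.1 hx).2]]
    simp

lemma sum_cornerChain (hA : ∀ i ∈ Finset.Icc 1 n, Adm n (F i)) {a : ℕ} (ha : a ≤ n) {l : List ℕ}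
    (h : IsCornersFrom (n := n) (fun i => (F i).card) a l) :
    ((cornerChain F a l).map Prod.snd).sum = n - a := by
  induction l generalizing a with
  | nil =>
    have := h.le_of_nil hA
    simp only [cornerChain, List.map_nil, List.sum_nil]
    omega
  | cons i l ih =>
    have hi := ((h.mem_iff i).1 (by simp)).1
    rw [cornerChain, List.map_cons, List.sum_cons, ih hi.2 h.of_cons]
    omega

lemma exists_of_mem_cornerChain {a : ℕ} {l : List ℕ} {x : Finset (PM n) × ℕ}
    (hx : x ∈ cornerChain F a l) : ∃ i ∈ l, x.1 = F i := by
  induction l generalizing a with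
  | nil => simp [cornerChain] at hx
  | cons i l ih =>
    rw [cornerChain, List.mem_cons] at hx
    rcases hx with rfl | hx
    · exact ⟨i, by simp, rfl⟩
    · obtain ⟨j, hj, hxj⟩ := ih hx
      exact ⟨j, by simp [hj], hxj⟩

lemma isWeightedChain_cornerChain (hA : ∀ i ∈ Finset.Icc 1 n, Adm n (F i))
    (hF : ∀ i j, 1 ≤ i → i ≤ j → j ≤ n → F j ⊆ F i) {a : ℕ} {l : List ℕ}
    (h : IsCornersFrom (n := n) (fun i => (F i).card) a l) :
    IsWeightedChain (cornerChain F a l) := by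
  induction l generalizing a with
  | nil => constructor <;> simp [cornerChain]
  | cons i l ih =>
    have hi := (h.mem_iff i).1 (by simp)
    obtain ⟨h1, h2, h3⟩ := ih h.of_cons
    refine ⟨List.pairwise_cons.2 ⟨fun y hy => ?_, h1⟩, ?_, ?_⟩
    · obtain ⟨j, hj, hyj⟩ := exists_of_mem_cornerChain hy
      have hj' := ((h.of_cons.mem_iff j).1 hj).1
      have hlt := hi.2
      rw [lamE_card (by omega), lamE_card (by omega)] at hlt
      rw [hyj]
      refine (hF (i + 1) j (by omega) (by omega) (by omega)).trans_ssubset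
        ((hF i (i + 1) (by omega) (by omega) (by omega)).ssubset_of_ne fun he => ?_)
      rw [he] at hlt
      exact lt_irrefl _ hlt
    · exact List.forall_mem_cons.2 ⟨hA i (Finset.mem_Icc.2 ⟨by omega, by omega⟩), h2⟩
    · exact List.forall_mem_cons.2 ⟨by change 1 ≤ i - a; omega, h3⟩

lemma tailWeight_cornerChain {a : ℕ} (ha : a ≤ n) {l : List ℕ}
    (hA : ∀ i ∈ Finset.Icc 1 n, Adm n (F i))
    (h : IsCornersFrom (n := n) (fun i => (F i).card) a l) {e : ℕ → ℕ}
    (he : e = lamE n fun i => (F i).card) {c : ℕ → ℕ}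
    (hc : c = fun r => (a :: l).getD r (n + 1)) :
    (-1) ^ (n - a + l.length) * ∏ r ∈ Finset.range l.length,
      (Cb (c (r + 1) - c r - 1) (e (c (r + 1)) + c (r + 1) - n - 1) *
        Cb (e (c (r + 1)) - e (c (r + 2)) - 1) (e (c (r + 1)) + c (r + 1) - n - 1)) =
      tailWeight (n - a) (cornerChain F a l) := by
  induction l generalizing a c with
  | nil =>
    have := h.le_of_nil hA
    simp [cornerChain, tailWeight, show n - a = 0 by omega]
  | cons i l ih =>
    have hi := ((h.mem_iff i).1 (by simp)).1
    have hei : e i = (F i).card := by rw [he, lamE_card hi.2]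
    have hhead : e (l.getD 0 (n + 1)) = (headSet (cornerChain F i l)).card := by
      cases l with
      | nil => simp [he, lamE, headSet, cornerChain]
      | cons j l =>
        have hj := ((h.of_cons.mem_iff j).1 (by simp)).1
        simp [he, lamE_card hj.2, headSet, cornerChain]
    have hih := ih hi.2 h.of_cons rfl
    simp only [List.getD_cons_succ] at hih
    rw [cornerChain, tailWeight, show ((n : ℤ) - a - (i - a : ℕ)) = n - i by omega, ← hih,
      List.length_cons, Finset.prod_range_succ', hc]
    simp only [List.getD_cons_succ, List.getD_cons_zero, hhead, hei]
    rw [Cb_symm (x := (i : ℤ) - a - 1), Cb_symm (x := (F i).card - _ - 1),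
      show n - a + (l.length + 1) = (i - a + 1) + (n - i + l.length) by omega, pow_add,
      show ((i - a : ℕ) : ℤ) = i - a by omega,
      show (i : ℤ) - a - 1 - ((F i).card + i - n - 1) = n - a - (F i).card by ring,
      show ((F i).card : ℤ) - (headSet (cornerChain F i l)).card - 1 -
        ((F i).card + i - n - 1) = n - i - (headSet (cornerChain F i l)).card by ring]
    ring

lemma two_pow_mul_IY (hn : 1 ≤ n) (hA : ∀ i ∈ Finset.Icc 1 n, Adm n (F i))
    (hF : ∀ i j, 1 ≤ i → i ≤ j → j ≤ n → F j ⊆ F i) :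
    2 ^ (n - (F 1).card) * IY n (fun i => (F i).card) =
      weight n none (cornerChain F 0 (cornerL n fun i => (F i).card)) := by
  have h := isCornersFrom_cornerL (n := n) fun i => (F i).card
  have ht := tailWeight_cornerChain (Nat.zero_le n) hA h rfl rfl
  have hiC : iC n (fun i => (F i).card) =
      fun r => (0 :: cornerL n fun i => (F i).card).getD r (n + 1) := by
    funext r
    cases r <;> simp [iC]
  have hhead : headSet (cornerChain F 0 (cornerL n fun i => (F i).card)) = F 1 := by
    generalize cornerL n (fun i => (F i).card) = l at h
    cases l with
    | nil => exact absurd (h.le_of_nil hA) (by omega)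
    | cons i l => exact (h.eq_of_mem_Ioc hF one_pos ((h.mem_iff i).1 (by simp)).1.1).symm
  rw [Nat.cast_zero, sub_zero, Nat.sub_zero] at ht
  rw [weight, hhead, ← ht, gap, IY, sC, ← Finset.Ico_add_one_right_eq_Icc,
    Finset.prod_Ico_eq_prod_range, Nat.add_sub_cancel,
    show ((n : ℤ) - (F 1).card).toNat = n - (F 1).card by omega]
  congr 2
  refine Finset.prod_congr rfl fun r _ => ?_
  rw [add_comm 1 r]
  simp only [yC, aC, bC, cC, hiC, add_tsub_cancel_right]

end TypeB

/-- For a chain `S_1 ⊆ … ⊆ S_n` of admissible subsets of `[±n]`, with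
`λ_i = |S_{n+1−i}|`, one has `τ_{S_1} ⋯ τ_{S_n} = 2^{n−λ_1} I(λ) · τ_{{1}} ⋯ τ_{{1,…,n}}`
in `R^B_n`. -/
theorem typeB_intersection_formula (n : ℕ) (hn : 1 ≤ n)
    (S : ℕ → Finset (PM n))
    (hadm : ∀ i ∈ Finset.Icc 1 n, Adm n (S i))
    (hchain : ∀ i j, 1 ≤ i → i ≤ j → j ≤ n → S i ⊆ S j) :
    (∏ i ∈ Finset.Icc 1 n, tauB n (S i)) =
      ((2 ^ (n - (S n).card) * IY n (fun i => (S (n + 1 - i)).card) : ℤ) : RB n) * ptB n := by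
  have hF : ∀ i j, 1 ≤ i → i ≤ j → j ≤ n → S (n + 1 - j) ⊆ S (n + 1 - i) := fun i j hi hij hj =>
    hchain _ _ (by omega) (by omega) (by omega)
  have hA : ∀ i ∈ Finset.Icc 1 n, Adm n (S (n + 1 - i)) := fun i hi => by
    rw [Finset.mem_Icc] at hi
    exact hadm _ (Finset.mem_Icc.2 ⟨by omega, by omega⟩)
  have hc := TypeB.isCornersFrom_cornerL (n := n) fun i => (S (n + 1 - i)).card
  have hI := TypeB.two_pow_mul_IY hn hA hF
  rw [Nat.add_sub_cancel] at hI
  rw [hI, ← TypeB.monom_eq_weight_mul_ptB (TypeB.isWeightedChain_cornerChain hA hF hc)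
    (by simpa using TypeB.sum_cornerChain hA (Nat.zero_le n) hc),
    ← TypeB.prod_Ioc_eq_monom_cornerChain hA hF hc]
  refine Finset.prod_nbij' (fun i => n + 1 - i) (fun i => n + 1 - i) ?_ ?_ ?_ ?_ ?_ <;>
    simp only [Finset.mem_Icc, Finset.mem_Ioc]
  · omega
  · omega
  · omega
  · omega
  · intro i hi
    rw [show n + 1 - (n + 1 - i) = i by omega]
end

section
/- Let B be an admissible subset of [±n] with |B| = n and let k ∈ B. Then in R^B_n one has τ_B² = − Σ τ_{B'}·τ_B, where the sum runs over all admissible subsets B' ⊊ B with k ∈ B'. -/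
open MvPolynomial

theorem Adm.card_le {n : ℕ} {S : Finset (PM n)} (hS : Adm n S) : S.card ≤ n := by
  have hinj : Set.InjOn Prod.fst (S : Set (PM n)) := by
    rintro ⟨a, b⟩ hp ⟨a', b'⟩ hq (rfl : a = a')
    by_contra hne
    have hb : b' = !b := by cases b <;> cases b' <;> simp_all
    subst hb
    exact hS.2 _ hp hq
  simpa using Finset.card_le_card_of_injOn (t := Finset.univ) Prod.fst (by simp) hinj

theorem tauB_mul_eq_zero {n : ℕ} {S T : Finset (PM n)} (hS : Adm n S) (hT : Adm n T)
    (hST : ¬ S ⊆ T) (hTS : ¬ T ⊆ S) : tauB n S * tauB n T = 0 := by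
  rw [tauB, tauB, dif_pos hS, dif_pos hT, ← map_mul]
  exact Ideal.Quotient.eq_zero_iff_mem.2
    (Ideal.subset_span (Or.inl ⟨⟨S, hS⟩, ⟨T, hT⟩, hST, hTS, rfl⟩))

theorem mk_sum_X_eq_sum_tauB {n : ℕ} (p : PM n) :
    Ideal.Quotient.mk (Ideal.span (relB n))
        (∑ S : IdxB n, if p ∈ S.1 then X S else 0) =
      ∑ S : Finset (PM n), if Adm n S ∧ p ∈ S then tauB n S else 0 := by
  simp_rw [ite_and]
  rw [map_sum, ← Finset.sum_filter (Adm n),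
    Finset.sum_subtype (Finset.univ.filter (Adm n)) (p := Adm n) (by simp)]
  refine Finset.sum_congr rfl fun S _ => ?_
  split_ifs
  · rw [tauB, dif_pos S.2]
  · exact map_zero _

theorem sum_tauB_mem_eq_sum_tauB_negPM_mem {n : ℕ} (p : PM n) :
    (∑ S : Finset (PM n), if Adm n S ∧ p ∈ S then tauB n S else 0) =
      ∑ S : Finset (PM n), if Adm n S ∧ negPM p ∈ S then tauB n S else 0 := by
  obtain ⟨k, b⟩ := p
  have h := Ideal.Quotient.eq.2 (Ideal.subset_span (s := relB n) (Set.mem_union_right _ ⟨k, rfl⟩))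
  rw [mk_sum_X_eq_sum_tauB, mk_sum_X_eq_sum_tauB] at h
  cases b
  · exact h.symm
  · exact h

/-- For an admissible `B ⊆ [±n]` with `|B| = n` and `k ∈ B`, one has
`τ_B² = − Σ_{B' ⊊ B admissible, k ∈ B'} τ_{B'} τ_B` in `R^B_n`. -/
theorem typeB_separation_long (n : ℕ) (hn : 1 ≤ n)
    (B : Finset (PM n)) (hB : Adm n B) (hcard : B.card = n) (k : PM n) (hk : k ∈ B) :
    tauB n B ^ 2 =
      - ∑ B' : Finset (PM n),
          if Adm n B' ∧ B' ⊂ B ∧ k ∈ B' then tauB n B' * tauB n B else 0 := by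
  have hmax : ∀ S, Adm n S → B ⊆ S → S = B := fun S hS hBS =>
    (Finset.eq_of_subset_of_card_le hBS (hS.card_le.trans_eq hcard.symm)).symm
  have hneg : (∑ S : Finset (PM n), if Adm n S ∧ negPM k ∈ S then tauB n S else 0) *
      tauB n B = 0 := by
    rw [Finset.sum_mul]
    refine Finset.sum_eq_zero fun S _ => ?_
    split_ifs with h
    · have hkB := hB.2 k hk
      refine tauB_mul_eq_zero h.1 hB (fun hSB => hkB (hSB h.2)) fun hBS => ?_
      exact hkB (hmax S h.1 hBS ▸ h.2)
    · exact zero_mul _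
  rw [← sum_tauB_mem_eq_sum_tauB_negPM_mem, Finset.sum_mul,
    ← Finset.add_sum_erase _ _ (Finset.mem_univ B), if_pos ⟨hB, hk⟩, ← sq] at hneg
  rw [eq_neg_of_add_eq_zero_left hneg,
    ← Finset.add_sum_erase (a := B) (h := Finset.mem_univ B),
    if_neg (fun h => h.2.1.ne rfl), zero_add]
  congr 1
  refine Finset.sum_congr rfl fun S hS => ?_
  have hne : S ≠ B := Finset.ne_of_mem_erase hS
  by_cases hSB : S ⊆ B
  · simp [ite_mul, hSB.ssubset_of_ne hne]
  · rw [if_neg (c := Adm n S ∧ S ⊂ B ∧ k ∈ S) (fun h => hSB h.2.1.subset)]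
    split_ifs with h
    · exact tauB_mul_eq_zero h.1 hB hSB fun hBS => hne (hmax S h.1 hBS)
    · exact zero_mul _
end

section
/- Let B be an admissible subset of [±n], let k ∈ B, and let l ∈ [±n] with l ∉ B and −l ∉ B (so 1 ≤ |B| ≤ n−1). Then in R^B_n one has τ_B² = − Σ_{B' : k∈B', l∉B', −l∉B', B'≠B} τ_{B'}·τ_B − 2·Σ_{B' : k∈B', −l∈B'} τ_{B'}·τ_B, the sums running over admissible subsets B' of [±n] with the indicated properties. -/
open MvPolynomial

/-- The sum of the classes `τ_S` over the admissible `S` containing `p`. -/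
noncomputable def tauSum (n : ℕ) (p : PM n) : RB n :=
  ∑ S : Finset (PM n), if Adm n S ∧ p ∈ S then tauB n S else 0

theorem tauSum_eq_mk {n : ℕ} (p : PM n) :
    tauSum n p = Ideal.Quotient.mk (Ideal.span (relB n))
      (∑ S : IdxB n, if p ∈ S.1 then X S else 0) := by
  rw [map_sum, tauSum]
  simp only [ite_and]
  rw [← Finset.sum_filter, Finset.sum_subtype (p := Adm n) _ (by simp)]
  refine Finset.sum_congr rfl fun S _ => ?_
  split_ifs
  · rw [tauB, dif_pos S.2]
  · rw [map_zero]

theorem tauSum_negPM {n : ℕ} (p : PM n) : tauSum n (negPM p) = tauSum n p := by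
  have key (k : Fin n) : tauSum n (k, true) = tauSum n (k, false) := by
    rw [tauSum_eq_mk, tauSum_eq_mk, Ideal.Quotient.eq]
    exact Ideal.subset_span (Or.inr ⟨k, rfl⟩)
  obtain ⟨k, b⟩ := p
  cases b
  · exact key k
  · exact (key k).symm

theorem tauSum_mul_tauB {n : ℕ} (p : PM n) (B : Finset (PM n)) :
    tauSum n p * tauB n B =
      ∑ S : Finset (PM n), if Adm n S ∧ p ∈ S then tauB n S * tauB n B else 0 := by
  simp only [tauSum, Finset.sum_mul, ite_mul, zero_mul]

theorem tauSum_mul_tauB_eq_zero {n : ℕ} {B : Finset (PM n)} (hB : Adm n B) {k : PM n}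
    (hk : k ∈ B) : tauSum n k * tauB n B = 0 := by
  rw [← tauSum_negPM, tauSum_mul_tauB]
  refine Finset.sum_eq_zero fun S _ => ?_
  split_ifs with h
  · exact tauB_mul_eq_zero h.1 hB (fun hs => hB.2 k hk (hs h.2))
      (fun hs => h.1.2 k (hs hk) h.2)
  · rfl

/-- For `k ∈ B` and `p ∉ B`, only the sets containing `k` contribute to `tauSum n p * τ_B`. -/
theorem tauSum_mul_tauB_of_notMem {n : ℕ} {B : Finset (PM n)} (hB : Adm n B) {k p : PM n}
    (hk : k ∈ B) (hp : p ∉ B) :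
    tauSum n p * tauB n B =
      ∑ S : Finset (PM n), if Adm n S ∧ k ∈ S ∧ p ∈ S then tauB n S * tauB n B else 0 := by
  rw [tauSum_mul_tauB]
  refine Finset.sum_congr rfl fun S _ => ?_
  by_cases hkS : k ∈ S
  · simp [hkS]
  · simp only [hkS, false_and, and_false, if_false, ite_eq_right_iff]
    exact fun h => tauB_mul_eq_zero h.1 hB (fun hs => hp (hs h.2)) (fun hs => hkS (hs hk))

/-- For an admissible `B ⊆ [±n]`, `k ∈ B`, and `l ∈ [±n]` with `l ∉ B` and
`−l ∉ B`, one has, in `R^B_n`,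
`τ_B² = − Σ_{B' : k∈B', ±l∉B', B'≠B} τ_{B'} τ_B − 2 Σ_{B' : k∈B', −l∈B'} τ_{B'} τ_B`,
the sums over admissible subsets `B'` of `[±n]`. -/
theorem typeB_separation_short (n : ℕ) (hn : 1 ≤ n)
    (B : Finset (PM n)) (hB : Adm n B) (k : PM n) (hk : k ∈ B)
    (l : PM n) (hl : l ∉ B) (hnl : negPM l ∉ B) :
    tauB n B ^ 2 =
      - (∑ B' : Finset (PM n),
          if Adm n B' ∧ k ∈ B' ∧ l ∉ B' ∧ negPM l ∉ B' ∧ B' ≠ B then tauB n B' * tauB n B else 0)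
      - 2 * ∑ B' : Finset (PM n),
          if Adm n B' ∧ k ∈ B' ∧ negPM l ∈ B' then tauB n B' * tauB n B else 0 := by
  have hkl := tauSum_mul_tauB_of_notMem hB hk hl
  have hknl := tauSum_mul_tauB_of_notMem hB hk hnl
  rw [tauSum_negPM, hkl] at hknl
  have hsplit : tauSum n k * tauB n B =
      tauB n B ^ 2 +
      (∑ S : Finset (PM n),
        if Adm n S ∧ k ∈ S ∧ l ∉ S ∧ negPM l ∉ S ∧ S ≠ B then tauB n S * tauB n B else 0) +
      (∑ S : Finset (PM n), if Adm n S ∧ k ∈ S ∧ l ∈ S then tauB n S * tauB n B else 0) +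
      ∑ S : Finset (PM n), if Adm n S ∧ k ∈ S ∧ negPM l ∈ S then tauB n S * tauB n B else 0 := by
    have hsq : tauB n B ^ 2 =
        ∑ S : Finset (PM n), if S = B then tauB n S * tauB n B else 0 := by
      rw [Finset.sum_ite_eq' Finset.univ B, if_pos (Finset.mem_univ B), sq]
    rw [tauSum_mul_tauB, hsq, ← Finset.sum_add_distrib, ← Finset.sum_add_distrib,
      ← Finset.sum_add_distrib]
    refine Finset.sum_congr rfl fun S _ => ?_
    by_cases hSB : S = B
    · subst hSB
      simp [hB, hk, hl, hnl]
    · by_cases hS : Adm n S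
      · have := hS.2 l
        by_cases h1 : l ∈ S <;> by_cases h2 : negPM l ∈ S <;> simp_all
      · simp [hSB, hS]
  rw [tauSum_mul_tauB_eq_zero hB hk, hknl] at hsplit
  linear_combination -hsplit
end
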